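/- Let Z be an integrable real-valued random variable and let p ∈ (0,1). Then the supremum in the characterization S̲_p[Z] = sup_{η ∈ ℝ} { η − (1/p)·E[max(η − Z, 0)] } is attained at η = Q_Z(p), i.e., S̲_p[Z] = Q_Z(p) − (1/p)·E[max(Q_Z(p) − Z, 0)]. -/

import Mathlib

open MeasureTheory

/-- The cumulative distribution function `F_Z(t) = P(Z ≤ t)` of a random variable `Z`. -/
noncomputable def cdfRV {Ω : Type*} [MeasurableSpace Ω] (μ : Measure Ω) (Z : Ω → ℝ) (t : ℝ) : ℝ :=
  (μ {ω | Z ω ≤ t}).toReal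

/-- The quantile function `Q_Z(u) = inf {t : F_Z(t) ≥ u}` of a random variable `Z`. -/
noncomputable def quantileRV {Ω : Type*} [MeasurableSpace Ω] (μ : Measure Ω) (Z : Ω → ℝ)
    (u : ℝ) : ℝ :=
  sInf {t : ℝ | u ≤ cdfRV μ Z t}

lemma cdfRV_eq {Ω : Type*} [MeasurableSpace Ω] (μ : Measure Ω)
    [IsProbabilityMeasure μ] (Z : Ω → ℝ) (hZ : Measurable Z) (t : ℝ) :
    cdfRV μ Z t = ProbabilityTheory.cdf (μ.map Z) t := by
  have : IsProbabilityMeasure (μ.map Z) := Measure.isProbabilityMeasure_map hZ.aemeasurable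
  rw [ProbabilityTheory.cdf_eq_real, Measure.real, Measure.map_apply hZ measurableSet_Iic]
  rfl

lemma quantileRV_le_iff {Ω : Type*} [MeasurableSpace Ω] (μ : Measure Ω)
    [IsProbabilityMeasure μ] (Z : Ω → ℝ) (hZ : Measurable Z) (u : ℝ)
    (hu : u ∈ Set.Ioo (0 : ℝ) 1) (t : ℝ) :
    quantileRV μ Z u ≤ t ↔ u ≤ cdfRV μ Z t := by
  have hmono : Monotone (cdfRV μ Z) := by
    intro a b hab
    rw [cdfRV_eq μ Z hZ, cdfRV_eq μ Z hZ]
    exact ProbabilityTheory.monotone_cdf _ hab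
  have hbdd : BddBelow {t : ℝ | u ≤ cdfRV μ Z t} := by
    obtain ⟨a, ha⟩ := ((ProbabilityTheory.tendsto_cdf_atBot (μ.map Z)).eventually
      (gt_mem_nhds hu.1)).exists
    refine ⟨a, fun t ht => ?_⟩
    by_contra! h
    have h1 := hmono h.le
    rw [cdfRV_eq μ Z hZ a] at h1
    have : u ≤ cdfRV μ Z t := ht
    linarith
  have hne : {t : ℝ | u ≤ cdfRV μ Z t}.Nonempty := by
    obtain ⟨a, ha⟩ := ((ProbabilityTheory.tendsto_cdf_atTop (μ.map Z)).eventually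
      (lt_mem_nhds hu.2)).exists
    refine ⟨a, ?_⟩
    change u ≤ cdfRV μ Z a
    rw [cdfRV_eq μ Z hZ a]
    exact ha.le
  constructor
  · intro h
    have hlim : Filter.Tendsto (cdfRV μ Z) (nhdsWithin t (Set.Ioi t)) (nhds (cdfRV μ Z t)) := by
      have := ((ProbabilityTheory.cdf (μ.map Z)).right_continuous t).mono Set.Ioi_subset_Ici_self
      have e : cdfRV μ Z = fun s => ProbabilityTheory.cdf (μ.map Z) s :=
        funext (cdfRV_eq μ Z hZ)
      rw [e]
      exact this
    refine ge_of_tendsto hlim ?_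
    filter_upwards [self_mem_nhdsWithin] with s hs
    obtain ⟨r, hr, hrs⟩ := exists_lt_of_csInf_lt hne (lt_of_le_of_lt h hs)
    exact le_trans hr (hmono hrs.le)
  · intro h
    exact csInf_le hbdd h

lemma quantileRV_mono {Ω : Type*} [MeasurableSpace Ω] (μ : Measure Ω)
    [IsProbabilityMeasure μ] (Z : Ω → ℝ) (hZ : Measurable Z) :
    MonotoneOn (quantileRV μ Z) (Set.Ioo (0 : ℝ) 1) := by
  intro u hu v hv huv
  rw [quantileRV_le_iff μ Z hZ u hu]
  exact huv.trans ((quantileRV_le_iff μ Z hZ v hv _).1 le_rfl)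

lemma quantileRV_aemeas {Ω : Type*} [MeasurableSpace Ω] (μ : Measure Ω)
    [IsProbabilityMeasure μ] (Z : Ω → ℝ) (hZ : Measurable Z) :
    AEMeasurable (quantileRV μ Z) (volume.restrict (Set.Ioo (0 : ℝ) 1)) :=
  aemeasurable_restrict_of_monotoneOn measurableSet_Ioo (quantileRV_mono μ Z hZ)

lemma quantileRV_map {Ω : Type*} [MeasurableSpace Ω] (μ : Measure Ω)
    [IsProbabilityMeasure μ] (Z : Ω → ℝ) (hZ : Measurable Z) :
    (volume.restrict (Set.Ioo (0 : ℝ) 1)).map (quantileRV μ Z) = μ.map Z := by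
  have : IsProbabilityMeasure (μ.map Z) := Measure.isProbabilityMeasure_map hZ.aemeasurable
  refine Measure.ext_of_Iic _ _ fun t => ?_
  rw [Measure.map_apply_of_aemeasurable (quantileRV_aemeas μ Z hZ) measurableSet_Iic,
    Measure.restrict_apply' measurableSet_Ioo, ← ProbabilityTheory.ofReal_cdf, ← cdfRV_eq μ Z hZ]
  have h1 : cdfRV μ Z t ≤ 1 := by
    rw [cdfRV_eq μ Z hZ]; exact ProbabilityTheory.cdf_le_one _ _
  have e : quantileRV μ Z ⁻¹' Set.Iic t ∩ Set.Ioo (0 : ℝ) 1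
      = Set.Iic (cdfRV μ Z t) ∩ Set.Ioo (0 : ℝ) 1 := by
    ext u
    simp only [Set.mem_inter_iff, Set.mem_preimage, Set.mem_Iic]
    constructor
    · rintro ⟨a, b⟩
      exact ⟨(quantileRV_le_iff μ Z hZ u b t).1 a, b⟩
    · rintro ⟨a, b⟩
      exact ⟨(quantileRV_le_iff μ Z hZ u b t).2 a, b⟩
  have e2 : Set.Iic (cdfRV μ Z t) ∩ Set.Ioc (0 : ℝ) 1 = Set.Ioc 0 (cdfRV μ Z t) := by
    ext u
    simp only [Set.mem_inter_iff, Set.mem_Iic, Set.mem_Ioc]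
    constructor
    · rintro ⟨a, b, c⟩
      exact ⟨b, a⟩
    · rintro ⟨a, b⟩
      exact ⟨b, a, b.trans h1⟩
  rw [e, measure_congr ((Filter.EventuallyEq.refl _ _).inter Ioo_ae_eq_Ioc), e2,
    Real.volume_Ioc, sub_zero]

/-- The supremum in the characterization of the subquantile is attained at `η = Q_Z(p)`:
`S̲_p[Z] = Q_Z(p) − (1/p)·E[max(Q_Z(p) − Z, 0)]`. -/
theorem subquantile_attained {Ω : Type*} [MeasurableSpace Ω] (μ : Measure Ω)
    [IsProbabilityMeasure μ] (Z : Ω → ℝ) (hZ : Measurable Z) (hZint : Integrable Z μ)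
    (p : ℝ) (hp : p ∈ Set.Ioo (0 : ℝ) 1) :
    (1 / p) * ∫ u in (0 : ℝ)..p, quantileRV μ Z u =
      quantileRV μ Z p - (1 / p) * ∫ ω, max (quantileRV μ Z p - Z ω) 0 ∂μ := by
  have hQ := quantileRV_aemeas μ Z hZ
  have hmap := quantileRV_map μ Z hZ
  have hint : IntegrableOn (quantileRV μ Z) (Set.Ioo (0 : ℝ) 1) := by
    have h1 : Integrable id (μ.map Z) :=
      (integrable_map_measure aestronglyMeasurable_id hZ.aemeasurable).2 hZint
    rw [← hmap] at h1
    exact (integrable_map_measure aestronglyMeasurable_id hQ).1 h1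
  have hsub : Set.Ioc 0 p ⊆ Set.Ioo (0 : ℝ) 1 := fun u hu => ⟨hu.1, hu.2.trans_lt hp.2⟩
  generalize hq : quantileRV μ Z p = q
  have hg : Measurable fun z : ℝ => max (q - z) 0 := by fun_prop
  have key : ∫ ω, max (q - Z ω) 0 ∂μ = ∫ u in Set.Ioc 0 p, (q - quantileRV μ Z u) := by
    rw [← integral_map (f := fun z : ℝ => max (q - z) 0) hZ.aemeasurable
      hg.aestronglyMeasurable, ← hmap, integral_map hQ hg.aestronglyMeasurable]
    rw [setIntegral_eq_of_subset_of_forall_sdiff_eq_zero measurableSet_Ioo hsub]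
    · refine setIntegral_congr_fun measurableSet_Ioc fun u hu => ?_
      have := quantileRV_mono μ Z hZ (hsub hu) hp hu.2
      exact max_eq_left (by linarith)
    · intro u hu
      have hpu : p ≤ u := by
        by_contra! h
        exact hu.2 ⟨hu.1.1, h.le⟩
      have := quantileRV_mono μ Z hZ hp hu.1 hpu
      exact max_eq_right (by linarith)
  have hp0 := hp.1
  rw [key, integral_sub (integrable_const _) (hint.mono_set hsub),
    intervalIntegral.integral_of_le hp0.le]
  simp only [integral_const, smul_eq_mul, measureReal_restrict_apply_univ,
    Real.volume_real_Ioc_of_le hp0.le]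
  field_simp
  ring
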